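/- Let (K,v) be an inseparably defectless valued field of characteristic p>0, let L|K be a finite field extension, and let w be any valuation on L extending v. Then (L,w) is again an inseparably defectless field. -/

import Mathlib

open scoped Classical

noncomputable section

namespace ValuedDefect

universe u v

variable {K : Type u} {L : Type v} [Field K] [Field L]

/-- The ramification index `(vL : vK)`: the index of the image of `Kˣ` in the
value group `Lˣ / Bˣ` of the valuation subring `B` of `L`. -/
def ramIndex (K : Type u) {L : Type v} [Field K] [Field L] [Algebra K L]
    (B : ValuationSubring L) : ℕ :=
  (Subgroup.map (QuotientGroup.mk' B.unitGroup)
    (MonoidHom.range (Units.map (algebraMap K L).toMonoidHom))).index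

/-- The ring homomorphism `A →+* B` induced by `algebraMap K L` when `B` lies above `A`. -/
def valHom [Algebra K L] (A : ValuationSubring K) (B : ValuationSubring L)
    (h : B.comap (algebraMap K L) = A) : A →+* B where
  toFun x := ⟨algebraMap K L x, by
    have hx : (x : K) ∈ B.comap (algebraMap K L) := by rw [h]; exact x.2
    exact ValuationSubring.mem_comap.mp hx⟩
  map_one' := Subtype.ext (by simp)
  map_mul' x y := Subtype.ext (by simp)
  map_zero' := Subtype.ext (by simp)
  map_add' x y := Subtype.ext (by simp)

theorem valHom_isLocalHom [Algebra K L] (A : ValuationSubring K) (B : ValuationSubring L)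
    (h : B.comap (algebraMap K L) = A) : IsLocalHom (valHom A B h) := by
  constructor
  intro x hx
  rcases isUnit_iff_exists_inv.mp hx with ⟨y, hy⟩
  have hy' : algebraMap K L (x : K) * (y : L) = 1 := congrArg Subtype.val hy
  have hx0 : (x : K) ≠ 0 := by
    rintro h0
    rw [h0, map_zero, zero_mul] at hy'
    exact zero_ne_one hy'
  have hyx : (y : L) = algebraMap K L ((x : K)⁻¹) := by
    rw [map_inv₀]
    exact eq_inv_of_mul_eq_one_right hy'
  have hmem : ((x : K)⁻¹ : K) ∈ A := by
    have hB : algebraMap K L ((x : K)⁻¹) ∈ B := hyx ▸ y.2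
    have := ValuationSubring.mem_comap.mpr hB
    rwa [h] at this
  refine isUnit_iff_exists_inv.mpr ⟨⟨(x : K)⁻¹, hmem⟩, Subtype.ext ?_⟩
  exact mul_inv_cancel₀ hx0

/-- The residue degree `[Lv : Kv]` of an extension of valuation subrings. -/
def residueDegree [Algebra K L] (A : ValuationSubring K) (B : ValuationSubring L) : ℕ :=
  if h : B.comap (algebraMap K L) = A then
    letI := valHom_isLocalHom A B h
    letI := (IsLocalRing.ResidueField.map (valHom A B h)).toAlgebra
    Module.finrank (IsLocalRing.ResidueField A) (IsLocalRing.ResidueField B)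
  else 0

/-- A finite extension of valued fields (with unique extension of the valuation) is
defectless if `[L : K] = (vL : vK) · [Lv : Kv]`. -/
def IsDefectless [Algebra K L] (A : ValuationSubring K) (B : ValuationSubring L) : Prop :=
  Module.finrank K L = ramIndex K B * residueDegree A B

/-- An extension of valued fields is immediate if `vL = vK` and `Lv = Kv`. -/
def IsImmediate (K : Type u) {L : Type v} [Field K] [Field L] [Algebra K L]
    (B : ValuationSubring L) : Prop :=
  (∀ x : L, x ≠ 0 → ∃ c : K, B.valuation x = B.valuation (algebraMap K L c)) ∧
  ∀ x : L, B.valuation x ≤ 1 → ∃ c : K, B.valuation (x - algebraMap K L c) < 1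

/-- A valued field is a defectless field if every finite extension is defectless. -/
def IsDefectlessField {K : Type u} [Field K] (A : ValuationSubring K) : Prop :=
  ∀ (L : Type u) [Field L] [Algebra K L], FiniteDimensional K L →
    ∀ B : ValuationSubring L, B.comap (algebraMap K L) = A → IsDefectless A B

/-- A valued field is a separably defectless field if every finite separable extension is
defectless. -/
def IsSepDefectlessField {K : Type u} [Field K] (A : ValuationSubring K) : Prop :=
  ∀ (L : Type u) [Field L] [Algebra K L], FiniteDimensional K L → Algebra.IsSeparable K L →
    ∀ B : ValuationSubring L, B.comap (algebraMap K L) = A → IsDefectless A B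

/-- A valued field is inseparably defectless if every finite purely inseparable extension is
defectless. -/
def IsInsepDefectless {K : Type u} [Field K] (A : ValuationSubring K) : Prop :=
  ∀ (L : Type u) [Field L] [Algebra K L], FiniteDimensional K L → IsPurelyInseparable K L →
    ∀ B : ValuationSubring L, B.comap (algebraMap K L) = A → IsDefectless A B

/-- A valued field is algebraically maximal if it admits no proper immediate algebraic
extension. -/
def IsAlgMaximal {K : Type u} [Field K] (A : ValuationSubring K) : Prop :=
  ∀ (L : Type u) [Field L] [Algebra K L], Algebra.IsAlgebraic K L →
    ∀ B : ValuationSubring L, B.comap (algebraMap K L) = A → IsImmediate K B →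
      Function.Surjective (algebraMap K L)

/-- A valued field is separable-algebraically maximal if it admits no proper immediate
separable-algebraic extension. -/
def IsSepAlgMaximal {K : Type u} [Field K] (A : ValuationSubring K) : Prop :=
  ∀ (L : Type u) [Field L] [Algebra K L], Algebra.IsAlgebraic K L → Algebra.IsSeparable K L →
    ∀ B : ValuationSubring L, B.comap (algebraMap K L) = A → IsImmediate K B →
      Function.Surjective (algebraMap K L)

/-- `(K,v)` is `K`-extremal with respect to `f` if the set `{v f(a) : a ∈ K}` has a maximum
(in the multiplicative convention: a minimum). -/
def KExtremal (A : ValuationSubring K) (f : Polynomial K) : Prop :=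
  ∃ a : K, ∀ b : K, A.valuation (f.eval a) ≤ A.valuation (f.eval b)

/-- `(K,v)` is `O`-extremal with respect to `f` if the set `{v f(a) : a ∈ O}` has a maximum. -/
def OExtremal (A : ValuationSubring K) (f : Polynomial K) : Prop :=
  ∃ a : A, ∀ b : A, A.valuation (f.eval (a : K)) ≤ A.valuation (f.eval (b : K))

/-- `K`-extremality for multivariable polynomials. -/
def KExtremalMv (A : ValuationSubring K) {n : ℕ} (f : MvPolynomial (Fin n) K) : Prop :=
  ∃ a : Fin n → K, ∀ b : Fin n → K,
    A.valuation (MvPolynomial.eval a f) ≤ A.valuation (MvPolynomial.eval b f)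

/-- A `p`-polynomial: an additive polynomial plus a constant. -/
def IsPPolynomial (p : ℕ) (f : Polynomial K) : Prop :=
  ∃ (c : K) (m : ℕ) (co : ℕ → K),
    f = Polynomial.C c + ∑ i ∈ Finset.range (m + 1), Polynomial.C (co i) * Polynomial.X ^ p ^ i

/-- A field of characteristic `p > 0` is Artin-Schreier closed if every polynomial
`X^p - X - a` has a root. -/
def ASClosed (K : Type*) [Field K] (p : ℕ) : Prop :=
  ∀ a : K, ∃ x : K, x ^ p - x = a

/-- The subfield `K^p` of `p`-th powers of a field of characteristic `p`. -/
def pPowerSubfield (K : Type*) [Field K] (p : ℕ) (hp : p.Prime) [CharP K p] : Subfield K :=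
  haveI : Fact p.Prime := ⟨hp⟩
  (frobenius K p).fieldRange

/-- The field `K^{1/p}` of `p`-th roots of `K` inside a purely inseparable extension `P`. -/
def pthRootField (K : Type u) (P : Type v) [Field K] [Field P] [Algebra K P]
    (p : ℕ) (hp : p.Prime) [CharP K p] : IntermediateField K P :=
  haveI : Fact p.Prime := ⟨hp⟩
  haveI : CharP P p := charP_of_injective_algebraMap (algebraMap K P).injective p
  { carrier := {x : P | x ^ p ∈ (algebraMap K P).range}
    mul_mem' := fun {a b} ha hb => by
      rcases ha with ⟨c, hc⟩
      rcases hb with ⟨d, hd⟩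
      exact ⟨c * d, by rw [map_mul, hc, hd, mul_pow]⟩
    one_mem' := ⟨1, by rw [map_one, one_pow]⟩
    add_mem' := fun {a b} ha hb => by
      rcases ha with ⟨c, hc⟩
      rcases hb with ⟨d, hd⟩
      exact ⟨c + d, by rw [map_add, hc, hd, add_pow_char]⟩
    zero_mem' := ⟨0, by rw [map_zero, zero_pow hp.ne_zero]⟩
    algebraMap_mem' := fun r => ⟨r ^ p, by rw [map_pow]⟩
    inv_mem' := fun x hx => by
      rcases hx with ⟨c, hc⟩
      exact ⟨c⁻¹, by rw [map_inv₀, hc, inv_pow]⟩ }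

/-- A (possibly infinite) algebraic extension of valued fields is defectless if every finite
subextension is defectless. -/
def IsDefectlessAlgExt {K : Type u} {L : Type v} [Field K] [Field L] [Algebra K L]
    (A : ValuationSubring K) (B : ValuationSubring L) : Prop :=
  ∀ E : IntermediateField K L, FiniteDimensional K E →
    IsDefectless A (B.comap (algebraMap E L))

section Subfields

variable {E : Type*} [Field E]

theorem finrank_eq_relfinrank_fieldRange {K L : Type*} [Field K] [Field L] [Algebra K L]
    (i : L →+* E) :
    Module.finrank K L = (i.comp (algebraMap K L)).fieldRange.relfinrank i.fieldRange := by
  rw [← RingHom.map_fieldRange, i.fieldRange_eq_map, Subfield.relfinrank_map_map,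
    Subfield.relfinrank_top_right]
  exact Algebra.finrank_eq_of_equiv_equiv
    (RingEquiv.ofBijective _ (algebraMap K L).rangeRestrictField_bijective)
    (RingEquiv.refl L) rfl

theorem relfinrank_ne_zero_iff {k l : Subfield E} (h : k ≤ l) :
    k.relfinrank l ≠ 0 ↔ FiniteDimensional k (Subfield.extendScalars h) := by
  rw [Subfield.relfinrank_eq_finrank_of_le h]
  exact ⟨fun h ↦ FiniteDimensional.of_finrank_pos (Nat.pos_of_ne_zero h),
    fun _ ↦ Module.finrank_pos.ne'⟩

theorem relfinrank_sup_ne_zero_and_le {k l x : Subfield E} (hl : k ≤ l) (hx : k ≤ x)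
    (h : k.relfinrank x ≠ 0) :
    l.relfinrank (l ⊔ x) ≠ 0 ∧ l.relfinrank (l ⊔ x) ≤ k.relfinrank x := by
  have hfin := (relfinrank_ne_zero_iff hx).mp h
  let _ : Algebra k l := (Subfield.inclusion hl).toAlgebra
  have : IsScalarTower k l E := IsScalarTower.of_algebraMap_eq fun _ ↦ rfl
  have hle : Module.rank l (IntermediateField.adjoin l (Subfield.extendScalars hx : Set E)) ≤
      Module.rank k (Subfield.extendScalars hx) :=
    IntermediateField.adjoin_rank_le_of_isAlgebraic_right l _
  have hlt := hle.trans_lt (Module.rank_lt_aleph0 k (Subfield.extendScalars hx))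
  have heq : Subfield.extendScalars (le_sup_left : l ≤ l ⊔ x) =
      IntermediateField.adjoin l (Subfield.extendScalars hx : Set E) := by
    apply le_antisymm
    · rw [Subfield.extendScalars_le_iff]
      refine sup_le (fun y hy ↦ ?_) fun y hy ↦ ?_
      · exact IntermediateField.algebraMap_mem _ (⟨y, hy⟩ : l)
      · exact IntermediateField.subset_adjoin l _ hy
    · rw [IntermediateField.adjoin_le_iff]
      exact fun y hy ↦ (le_sup_right : x ≤ l ⊔ x) hy
  have hfin' : FiniteDimensional l (Subfield.extendScalars (le_sup_left : l ≤ l ⊔ x)) := by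
    rw [heq]
    exact Module.rank_lt_aleph0_iff.mp hlt
  refine ⟨(relfinrank_ne_zero_iff le_sup_left).mpr hfin', ?_⟩
  rw [Subfield.relfinrank_eq_finrank_of_le le_sup_left, Subfield.relfinrank_eq_finrank_of_le hx,
    heq]
  exact Cardinal.toNat_le_toNat hle (Module.rank_lt_aleph0 k (Subfield.extendScalars hx))

theorem exists_finset_le_sup_closure {k l : Subfield E} (h : k ≤ l) (hfin : k.relfinrank l ≠ 0) :
    ∃ T : Finset E, (T : Set E) ⊆ l ∧ l ≤ k ⊔ Subfield.closure T := by
  have := (relfinrank_ne_zero_iff h).mp hfin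
  obtain ⟨T, hT⟩ := (Subfield.extendScalars h).fg_of_fg_toSubalgebra
    (Subalgebra.fg_of_fg_toSubmodule (Module.Finite.iff_fg.mp this))
  refine ⟨T, fun x hx ↦ ?_, ?_⟩
  · rw [← Subfield.coe_extendScalars h, ← hT]
    exact IntermediateField.subset_adjoin k _ hx
  · have := (IntermediateField.adjoin_le_iff (F := k) (S := (T : Set E))
      (T := Subfield.extendScalars (le_sup_left : k ≤ k ⊔ Subfield.closure T))).mpr
      (Subfield.subset_closure.trans (le_sup_right (a := k)))
    rwa [hT] at this

theorem relfinrank_closure_singleton_ne_zero {k : Subfield E} {x : E} (hx : IsIntegral k x) :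
    k.relfinrank (k ⊔ Subfield.closure {x}) ≠ 0 := by
  rw [relfinrank_ne_zero_iff le_sup_left]
  have heq : Subfield.extendScalars (le_sup_left : k ≤ k ⊔ Subfield.closure {x}) =
      IntermediateField.adjoin k {x} := by
    apply le_antisymm
    · rw [Subfield.extendScalars_le_iff]
      refine sup_le (fun y hy ↦ ?_) ?_
      · exact IntermediateField.algebraMap_mem _ (⟨y, hy⟩ : k)
      · rw [Subfield.closure_le]
        exact IntermediateField.subset_adjoin k _
    · rw [IntermediateField.adjoin_le_iff]
      exact Subfield.subset_closure.trans (le_sup_right (a := k))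
  rw [heq]
  exact IntermediateField.adjoin.finiteDimensional hx

theorem exists_finite_le_of_finset_subset_sup {k l f : Subfield E} (hf : k ≤ f)
    (halg : ∀ x ∈ f, IsIntegral k x) (T : Finset E) (hT : (T : Set E) ⊆ (l ⊔ f : Subfield E)) :
    ∃ e : Subfield E, k ≤ e ∧ e ≤ f ∧ k.relfinrank e ≠ 0 ∧ (T : Set E) ⊆ (l ⊔ e : Subfield E) := by
  have hsup : ∀ e₁ e₂ : Subfield E, k ≤ e₁ → k ≤ e₂ → k.relfinrank e₁ ≠ 0 →
      k.relfinrank e₂ ≠ 0 → k.relfinrank (e₁ ⊔ e₂) ≠ 0 := by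
    intro e₁ e₂ h₁ h₂ hn₁ hn₂
    rw [← Subfield.relfinrank_mul_relfinrank h₁ (le_sup_left : e₁ ≤ e₁ ⊔ e₂)]
    exact mul_ne_zero hn₁ (relfinrank_sup_ne_zero_and_le h₁ h₂ hn₂).1
  have hone : ∀ x ∈ (l ⊔ f : Subfield E),
      ∃ e : Subfield E, k ≤ e ∧ e ≤ f ∧ k.relfinrank e ≠ 0 ∧ x ∈ (l ⊔ e : Subfield E) := by
    intro x hx
    have hx' : x ∈ Subfield.closure ((l : Set E) ∪ f) := by
      rwa [Subfield.closure_union, Subfield.closure_eq, Subfield.closure_eq]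
    clear hx
    induction hx' using Subfield.closure_induction with
    | mem x hx =>
      rcases hx with hx | hx
      · exact ⟨k, le_rfl, hf, by simp, le_sup_left (a := l) hx⟩
      · exact ⟨k ⊔ Subfield.closure {x}, le_sup_left,
          sup_le hf (Subfield.closure_le.mpr (Set.singleton_subset_iff.mpr hx)),
          relfinrank_closure_singleton_ne_zero (halg x hx),
          (le_sup_right.trans le_sup_right : Subfield.closure {x} ≤ _)
            (Subfield.subset_closure rfl)⟩
    | one => exact ⟨k, le_rfl, hf, by simp, one_mem _⟩
    | add x y _ _ hx hy =>
      obtain ⟨e₁, h₁, h₁', hn₁, hx⟩ := hx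
      obtain ⟨e₂, h₂, h₂', hn₂, hy⟩ := hy
      exact ⟨e₁ ⊔ e₂, h₁.trans le_sup_left, sup_le h₁' h₂', hsup _ _ h₁ h₂ hn₁ hn₂,
        add_mem (sup_le_sup_left le_sup_left l hx) (sup_le_sup_left le_sup_right l hy)⟩
    | neg x _ hx =>
      obtain ⟨e, h, h', hn, hx⟩ := hx
      exact ⟨e, h, h', hn, neg_mem hx⟩
    | inv x _ hx =>
      obtain ⟨e, h, h', hn, hx⟩ := hx
      exact ⟨e, h, h', hn, inv_mem hx⟩
    | mul x y _ _ hx hy =>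
      obtain ⟨e₁, h₁, h₁', hn₁, hx⟩ := hx
      obtain ⟨e₂, h₂, h₂', hn₂, hy⟩ := hy
      exact ⟨e₁ ⊔ e₂, h₁.trans le_sup_left, sup_le h₁' h₂', hsup _ _ h₁ h₂ hn₁ hn₂,
        mul_mem (sup_le_sup_left le_sup_left l hx) (sup_le_sup_left le_sup_right l hy)⟩
  induction T using Finset.induction_on with
  | empty => exact ⟨k, le_rfl, hf, by simp, by simp⟩
  | insert a T _ ih =>
    rw [Finset.coe_insert, Set.insert_subset_iff] at hT
    obtain ⟨e₁, h₁, h₁', hn₁, ha⟩ := hone a hT.1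
    obtain ⟨e₂, h₂, h₂', hn₂, hT'⟩ := ih hT.2
    refine ⟨e₁ ⊔ e₂, h₁.trans le_sup_left, sup_le h₁' h₂', hsup _ _ h₁ h₂ hn₁ hn₂, ?_⟩
    rw [Finset.coe_insert, Set.insert_subset_iff]
    exact ⟨sup_le_sup_left le_sup_left l ha, hT'.trans (sup_le_sup_left le_sup_right l)⟩

end Subfields

section Relative

variable {Ω : Type*} [Field Ω] (C : ValuationSubring Ω)

/-- The value group of a subfield `k`, as a subgroup of the value group of the ambient field. -/
def valueSubgroup (k : Subfield Ω) : Subgroup C.ValueGroupˣ :=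
  (Units.map (C.valuation.toMonoidHom.comp k.subtype.toMonoidHom)).range

variable {C} in
theorem mem_valueSubgroup {k : Subfield Ω} {g : C.ValueGroupˣ} :
    g ∈ valueSubgroup C k ↔ ∃ x ∈ k, C.valuation x = g := by
  constructor
  · rintro ⟨u, rfl⟩
    exact ⟨_, (u : k).2, rfl⟩
  · rintro ⟨x, hx, hg⟩
    have hx0 : (⟨x, hx⟩ : k) ≠ 0 := by
      rintro h
      have : x = 0 := congrArg Subtype.val h
      rw [this, map_zero] at hg
      exact g.ne_zero hg.symm
    exact ⟨Units.mk0 _ hx0, Units.ext hg⟩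

theorem valueSubgroup_mono {k l : Subfield Ω} (h : k ≤ l) :
    valueSubgroup C k ≤ valueSubgroup C l := by
  intro g hg
  obtain ⟨x, hx, hg⟩ := mem_valueSubgroup.mp hg
  exact mem_valueSubgroup.mpr ⟨x, h hx, hg⟩

/-- The residue field of a subfield `k`, as a subfield of the residue field of the ambient
field. -/
def residueSubfield (k : Subfield Ω) : Subfield (IsLocalRing.ResidueField C) where
  carrier := {y | ∃ x : C, (x : Ω) ∈ k ∧ IsLocalRing.residue C x = y}
  mul_mem' := by
    rintro _ _ ⟨x, hx, rfl⟩ ⟨y, hy, rfl⟩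
    exact ⟨x * y, mul_mem hx hy, map_mul _ _ _⟩
  one_mem' := ⟨1, one_mem k, map_one _⟩
  add_mem' := by
    rintro _ _ ⟨x, hx, rfl⟩ ⟨y, hy, rfl⟩
    exact ⟨x + y, add_mem hx hy, map_add _ _ _⟩
  zero_mem' := ⟨0, zero_mem k, map_zero _⟩
  neg_mem' := by
    rintro _ ⟨x, hx, rfl⟩
    exact ⟨-x, neg_mem hx, map_neg _ _⟩
  inv_mem' := by
    rintro _ ⟨x, hx, rfl⟩
    by_cases h : IsLocalRing.residue C x = 0
    · exact ⟨0, zero_mem k, by rw [h, inv_zero, map_zero]⟩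
    · obtain ⟨u, rfl⟩ := (IsLocalRing.residue_ne_zero_iff_isUnit x).mp h
      refine ⟨((u⁻¹ : Cˣ) : C), ?_, ?_⟩
      · have : (((u⁻¹ : Cˣ) : C) : Ω) = ((u : C) : Ω)⁻¹ :=
          eq_inv_of_mul_eq_one_right (congrArg Subtype.val u.mul_inv)
        rw [this]
        exact inv_mem hx
      · refine eq_inv_of_mul_eq_one_right ?_
        rw [← map_mul, u.mul_inv, map_one]

variable {C} in
theorem mem_residueSubfield {k : Subfield Ω} {y : IsLocalRing.ResidueField C} :
    y ∈ residueSubfield C k ↔ ∃ x : C, (x : Ω) ∈ k ∧ IsLocalRing.residue C x = y :=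
  Iff.rfl

theorem residueSubfield_mono {k l : Subfield Ω} (h : k ≤ l) :
    residueSubfield C k ≤ residueSubfield C l :=
  fun _ ⟨x, hx, hy⟩ ↦ ⟨x, h hx, hy⟩

/-- The product of the ramification index and the residue degree of an extension of subfields
of a valued field. -/
def ramResidueProd (k l : Subfield Ω) : ℕ :=
  (valueSubgroup C k).relIndex (valueSubgroup C l) *
    (residueSubfield C k).relfinrank (residueSubfield C l)

theorem ramResidueProd_mul {k l m : Subfield Ω} (hkl : k ≤ l) (hlm : l ≤ m) :
    ramResidueProd C k l * ramResidueProd C l m = ramResidueProd C k m := by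
  unfold ramResidueProd
  rw [← Subgroup.relIndex_mul_relIndex _ _ _ (valueSubgroup_mono C hkl) (valueSubgroup_mono C hlm),
    ← Subfield.relfinrank_mul_relfinrank (residueSubfield_mono C hkl) (residueSubfield_mono C hlm)]
  ring

theorem valueSubgroup_fieldRange {F : Type*} [Field F] (j : F →+* Ω) :
    valueSubgroup C j.fieldRange =
      (Units.map (C.valuation.toMonoidHom.comp j.toMonoidHom)).range := by
  ext g
  rw [mem_valueSubgroup]
  constructor
  · rintro ⟨_, ⟨x, rfl⟩, hg⟩
    have hx : x ≠ 0 := by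
      rintro rfl
      rw [map_zero, map_zero] at hg
      exact g.ne_zero hg.symm
    exact ⟨Units.mk0 x hx, Units.ext hg⟩
  · rintro ⟨u, rfl⟩
    exact ⟨_, ⟨u, rfl⟩, rfl⟩

theorem residueSubfield_fieldRange {F : Type*} [Field F] (j : F →+* Ω) {D : ValuationSubring F}
    (f : D →+* C) [IsLocalHom f] (hf : ∀ x, (f x : Ω) = j x) (hD : C.comap j = D) :
    residueSubfield C j.fieldRange = (IsLocalRing.ResidueField.map f).fieldRange := by
  ext y
  rw [mem_residueSubfield]
  constructor
  · rintro ⟨x, ⟨z, hz⟩, rfl⟩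
    have hzD : z ∈ D := by
      rw [← hD, ValuationSubring.mem_comap, hz]
      exact x.2
    refine ⟨IsLocalRing.residue D ⟨z, hzD⟩, ?_⟩
    rw [IsLocalRing.ResidueField.map_residue]
    exact congrArg _ (Subtype.ext ((hf _).trans hz))
  · rintro ⟨z, rfl⟩
    obtain ⟨x, rfl⟩ := IsLocalRing.residue_surjective z
    exact ⟨f x, ⟨x, (hf x).symm⟩, (IsLocalRing.ResidueField.map_residue f x).symm⟩

theorem valuation_eq_one_iff_mem_and_inv_mem {F : Type*} [Field F] (D : ValuationSubring F)
    {x : F} (hx : x ≠ 0) : D.valuation x = 1 ↔ x ∈ D ∧ x⁻¹ ∈ D := by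
  rw [← D.valuation_le_one_iff, ← D.valuation_le_one_iff, map_inv₀,
    inv_le_one₀ (zero_lt_iff.mpr ((map_ne_zero _).mpr hx)), le_antisymm_iff]

variable {C} in
theorem ramIndex_eq_relIndex {K L : Type*} [Field K] [Field L] [Algebra K L]
    {B : ValuationSubring L} {i : L →+* Ω} (hi : C.comap i = B) :
    ramIndex K B = (valueSubgroup C (i.comp (algebraMap K L)).fieldRange).relIndex
      (valueSubgroup C i.fieldRange) := by
  have hker : (Units.map (C.valuation.toMonoidHom.comp i.toMonoidHom)).ker = B.unitGroup := by
    ext u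
    rw [← hi, ValuationSubring.mem_unitGroup_iff, MonoidHom.mem_ker, Units.ext_iff]
    change C.valuation (i u) = 1 ↔ _
    rw [valuation_eq_one_iff_mem_and_inv_mem _ ((map_ne_zero i).mpr u.ne_zero),
      valuation_eq_one_iff_mem_and_inv_mem _ u.ne_zero, ← map_inv₀]
    rfl
  have hL : valueSubgroup C i.fieldRange =
      (⊤ : Subgroup Lˣ).map (Units.map (C.valuation.toMonoidHom.comp i.toMonoidHom)) := by
    rw [valueSubgroup_fieldRange, MonoidHom.range_eq_map]
  have hK : valueSubgroup C (i.comp (algebraMap K L)).fieldRange =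
      (Units.map (algebraMap K L).toMonoidHom).range.map
        (Units.map (C.valuation.toMonoidHom.comp i.toMonoidHom)) := by
    rw [valueSubgroup_fieldRange, MonoidHom.map_range]
    rfl
  rw [ramIndex, hL, hK, Subgroup.relIndex_map_map, hker, ← Subgroup.relIndex_top_right,
    ← Subgroup.map_top_of_surjective _ (QuotientGroup.mk'_surjective B.unitGroup),
    Subgroup.relIndex_map_map, QuotientGroup.ker_mk']

variable {C} in
theorem residueDegree_eq_relfinrank {K L : Type*} [Field K] [Field L] [Algebra K L]
    {A : ValuationSubring K} {B : ValuationSubring L} (hB : B.comap (algebraMap K L) = A)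
    {i : L →+* Ω} (hi : C.comap i = B) :
    residueDegree A B = (residueSubfield C (i.comp (algebraMap K L)).fieldRange).relfinrank
      (residueSubfield C i.fieldRange) := by
  rw [residueDegree, dif_pos hB]
  let _ := valHom_isLocalHom A B hB
  let _ := (IsLocalRing.ResidueField.map (valHom A B hB)).toAlgebra
  let _ := i.toAlgebra
  let _ := valHom_isLocalHom B C hi
  refine (finrank_eq_relfinrank_fieldRange
    (IsLocalRing.ResidueField.map (valHom B C hi))).trans ?_
  rw [residueSubfield_fieldRange C i (valHom B C hi) (fun _ ↦ rfl) hi,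
    residueSubfield_fieldRange C (i.comp (algebraMap K L)) ((valHom B C hi).comp (valHom A B hB))
      (fun _ ↦ rfl) (by rw [← hB, ← hi]; rfl), IsLocalRing.ResidueField.map_comp]
  rfl

variable {C} in
theorem isDefectless_iff_relfinrank_eq {K L : Type*} [Field K] [Field L] [Algebra K L]
    {A : ValuationSubring K} {B : ValuationSubring L} (hB : B.comap (algebraMap K L) = A)
    {i : L →+* Ω} (hi : C.comap i = B) :
    IsDefectless A B ↔ (i.comp (algebraMap K L)).fieldRange.relfinrank i.fieldRange =
      ramResidueProd C (i.comp (algebraMap K L)).fieldRange i.fieldRange := by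
  rw [IsDefectless, ramResidueProd, ramIndex_eq_relIndex hi, residueDegree_eq_relfinrank hB hi,
    finrank_eq_relfinrank_fieldRange i]

theorem ramResidueProd_map {σ : Ω →+* Ω} (hσ : C.comap σ = C) {k l : Subfield Ω} (h : k ≤ l) :
    ramResidueProd C (k.map σ) (l.map σ) = ramResidueProd C k l := by
  let _ : Algebra k l := (Subfield.inclusion h).toAlgebra
  have h₁ : C.comap l.subtype = C.comap l.subtype := rfl
  have h₂ : C.comap (σ.comp l.subtype) = C.comap l.subtype := by
    rw [← ValuationSubring.comap_comap, hσ]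
  have hl : l.subtype.fieldRange = l := l.fieldRange_subtype
  have hk : (l.subtype.comp (algebraMap k l)).fieldRange = k := k.fieldRange_subtype
  have hl' : (σ.comp l.subtype).fieldRange = l.map σ := by
    rw [← RingHom.map_fieldRange, hl]
  have hk' : ((σ.comp l.subtype).comp (algebraMap k l)).fieldRange = k.map σ := by
    rw [RingHom.comp_assoc, ← RingHom.map_fieldRange, hk]
  rw [ramResidueProd, ← hl', ← hk', ← ramIndex_eq_relIndex h₂,
    ← residueDegree_eq_relfinrank rfl h₂, ramIndex_eq_relIndex h₁,
    residueDegree_eq_relfinrank rfl h₁, hl, hk, ramResidueProd]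

end Relative

section FundamentalInequality

variable {Ω : Type*} [Field Ω] {C : ValuationSubring Ω}

theorem exists_valuation_sum_mul_eq {k : Subfield Ω} {J : Type*} {b : J → C}
    (hb : LinearIndependent (residueSubfield C k) fun j ↦ IsLocalRing.residue C (b j))
    (t : Finset J) {c : J → Ω} (hc : ∀ j, c j ∈ k) (hne : ∃ j ∈ t, c j ≠ 0) :
    ∃ j ∈ t, c j ≠ 0 ∧ C.valuation (∑ j ∈ t, c j * b j) = C.valuation (c j) := by
  obtain ⟨j₁, hj₁, hcj₁⟩ := hne
  obtain ⟨j₀, hj₀, hmax⟩ := t.exists_max_image (fun j ↦ C.valuation (c j)) ⟨j₁, hj₁⟩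
  have hv : C.valuation (c j₀) ≠ 0 := fun h ↦
    hcj₁ ((map_eq_zero _).mp (le_zero_iff.mp (h ▸ hmax j₁ hj₁)))
  have hc₀ : c j₀ ≠ 0 := (map_ne_zero _).mp hv
  refine ⟨j₀, hj₀, hc₀, ?_⟩
  have hd : ∀ j ∈ t, c j / c j₀ ∈ C := fun j hj ↦ by
    rw [← C.valuation_le_one_iff, map_div₀]
    exact div_le_one_of_le₀ (hmax j hj) zero_le
  let d : J → C := fun j ↦ if h : c j / c j₀ ∈ C then ⟨_, h⟩ else 0
  have hdval : ∀ j ∈ t, (d j : Ω) = c j / c j₀ := fun j hj ↦ by simp [d, hd j hj]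
  have hdk : ∀ j, (d j : Ω) ∈ k := fun j ↦ by
    by_cases h : c j / c j₀ ∈ C
    · simpa [d, h] using div_mem (hc j) (hc j₀)
    · simp [d, h]
  have hsum : ∑ j ∈ t, c j * b j = c j₀ * ((∑ j ∈ t, d j * b j : C) : Ω) := by
    push_cast
    rw [Finset.mul_sum]
    refine Finset.sum_congr rfl fun j hj ↦ ?_
    rw [hdval j hj, ← mul_assoc, mul_div_cancel₀ _ hc₀]
  have hunit : IsUnit (∑ j ∈ t, d j * b j : C) := by
    rw [← IsLocalRing.residue_ne_zero_iff_isUnit]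
    intro h
    rw [map_sum] at h
    have h0 := linearIndependent_iff'.mp hb t
      (fun j ↦ ⟨IsLocalRing.residue C (d j), d j, hdk j, rfl⟩) (by
        rw [← h]
        exact Finset.sum_congr rfl fun j _ ↦ (map_mul _ _ _).symm) j₀ hj₀
    have h1 : d j₀ = 1 := Subtype.ext (by rw [hdval j₀ hj₀, div_self hc₀]; rfl)
    have h2 : IsLocalRing.residue C (d j₀) = 0 := congrArg Subtype.val h0
    rw [h1, map_one] at h2
    exact one_ne_zero h2
  rw [hsum, map_mul, (C.valuation_eq_one_iff _).mp hunit, mul_one]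

theorem linearIndependent_mul {k : Subfield Ω} {I J : Type*} {a : I → Ω} {b : J → C}
    (ha0 : ∀ i, a i ≠ 0)
    (ha : ∀ i i', ∀ x ∈ k, C.valuation (a i) = C.valuation (x * a i') → i = i')
    (hb : LinearIndependent (residueSubfield C k) fun j ↦ IsLocalRing.residue C (b j)) :
    LinearIndependent k fun ij : I × J ↦ a ij.1 * (b ij.2 : Ω) := by
  rw [linearIndependent_iff']
  intro s g hg
  let c : I → J → Ω := fun i j ↦ if (i, j) ∈ s then (g (i, j) : Ω) else 0
  have hck : ∀ i j, c i j ∈ k := fun i j ↦ by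
    by_cases h : (i, j) ∈ s <;> simp [c, h]
  let s₁ := s.image Prod.fst
  let s₂ := s.image Prod.snd
  let w : I → Ω := fun i ↦ ∑ j ∈ s₂, c i j * b j
  have hsum : ∑ i ∈ s₁, w i * a i = 0 := by
    rw [← hg]
    have hsub : s ⊆ s₁ ×ˢ s₂ := Finset.subset_product
    have h1 : ∑ i ∈ s, g i • (a i.1 * (b i.2 : Ω)) =
        ∑ i ∈ s, c i.1 i.2 * b i.2 * a i.1 := by
      refine Finset.sum_congr rfl fun ij hij ↦ ?_
      rw [Subfield.smul_def, smul_eq_mul]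
      simp only [c, Prod.mk.eta, if_pos hij]
      ring
    rw [h1, Finset.sum_subset hsub fun ij _ hij ↦ by simp [c, hij], Finset.sum_product]
    exact Finset.sum_congr rfl fun i _ ↦ Finset.sum_mul _ _ _
  have hw : ∀ i, (∃ j ∈ s₂, c i j ≠ 0) → ∃ x ∈ k, x ≠ 0 ∧ C.valuation (w i) = C.valuation x := by
    intro i hi
    obtain ⟨j, _, h0, hj⟩ := exists_valuation_sum_mul_eq hb s₂ (hck i) hi
    exact ⟨c i j, hck i j, h0, hj⟩
  have hw0 : ∀ i ∈ s₁, w i = 0 := by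
    by_contra! hcon
    obtain ⟨i₁, hi₁, hwi₁⟩ := hcon
    obtain ⟨i₀, hi₀, hmax⟩ := s₁.exists_max_image (fun i ↦ C.valuation (w i * a i)) ⟨i₁, hi₁⟩
    have hne : ∀ i, w i ≠ 0 → ∃ x ∈ k, x ≠ 0 ∧ C.valuation (w i) = C.valuation x := by
      intro i hi
      refine hw i ?_
      by_contra! h
      exact hi (Finset.sum_eq_zero fun j hj ↦ by rw [h j hj, zero_mul])
    have hv : C.valuation (w i₀ * a i₀) ≠ 0 := fun h ↦ by
      have := hmax i₁ hi₁
      simp only [h, le_zero_iff, map_eq_zero, mul_eq_zero, hwi₁, ha0, or_self] at this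
    have hwi₀ : w i₀ ≠ 0 := by
      rintro h
      simp [h] at hv
    have hlt : ∀ i ∈ s₁ \ {i₀}, C.valuation (w i * a i) < C.valuation (w i₀ * a i₀) := by
      intro i hi
      rw [Finset.mem_sdiff, Finset.mem_singleton] at hi
      refine lt_of_le_of_ne (hmax i hi.1) fun heq ↦ hi.2 ?_
      have hwi : w i ≠ 0 := by
        rintro h
        rw [h, zero_mul, map_zero] at heq
        exact hv heq.symm
      obtain ⟨x, hx, hx0, hvx⟩ := hne i hwi
      obtain ⟨y, hy, hy0, hvy⟩ := hne i₀ hwi₀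
      refine ha i i₀ (y / x) (div_mem hy hx) ?_
      have hvx0 : C.valuation x ≠ 0 := (map_ne_zero _).mpr hx0
      rw [map_mul, map_mul, hvx, hvy] at heq
      rw [map_mul, map_div₀, div_mul_eq_mul_div, eq_div_iff hvx0, ← heq, mul_comm]
    have := C.valuation.map_sum_eq_of_lt hi₀ hlt
    rw [hsum, map_zero] at this
    exact hv this.symm
  rintro ⟨i, j⟩ hij
  by_contra h0
  have hi : i ∈ s₁ := Finset.mem_image_of_mem Prod.fst hij
  have hj : j ∈ s₂ := Finset.mem_image_of_mem Prod.snd hij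
  obtain ⟨x, _, hx0, hvx⟩ := hw i ⟨j, hj, by simpa [c, hij] using h0⟩
  rw [hw0 i hi, map_zero] at hvx
  exact hx0 ((map_eq_zero _).mp hvx.symm)

theorem exists_finset_valueSubgroup_le {k l : Subfield Ω}
    (h : (valueSubgroup C k).relIndex (valueSubgroup C l) ≠ 0) :
    ∃ T : Finset Ω, (T : Set Ω) ⊆ l ∧ ∀ m : Subfield Ω, (T : Set Ω) ⊆ m →
      valueSubgroup C l ≤ valueSubgroup C k ⊔ valueSubgroup C m := by
  have hfin : Finite (valueSubgroup C l ⧸ (valueSubgroup C k).subgroupOf (valueSubgroup C l)) :=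
    Nat.finite_of_card_ne_zero h
  have hr : ∀ q : valueSubgroup C l ⧸ (valueSubgroup C k).subgroupOf (valueSubgroup C l),
      ∃ x ∈ l, C.valuation x = (q.out : C.ValueGroupˣ) := fun q ↦ mem_valueSubgroup.mp q.out.2
  choose a hal hav using hr
  refine ⟨(Set.finite_range a).toFinset, ?_, fun m hm g hg ↦ ?_⟩
  · rw [Set.Finite.coe_toFinset]
    rintro _ ⟨q, rfl⟩
    exact hal q
  · let q : valueSubgroup C l ⧸ (valueSubgroup C k).subgroupOf (valueSubgroup C l) :=
      QuotientGroup.mk ⟨g, hg⟩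
    have hq : (q.out : C.ValueGroupˣ)⁻¹ * g ∈ valueSubgroup C k := by
      have h₁ : (QuotientGroup.mk q.out :
          valueSubgroup C l ⧸ (valueSubgroup C k).subgroupOf (valueSubgroup C l)) =
          QuotientGroup.mk ⟨g, hg⟩ := q.out_eq'
      have h₂ := QuotientGroup.eq.mp h₁
      exact h₂
    have hqm : (q.out : C.ValueGroupˣ) ∈ valueSubgroup C m :=
      mem_valueSubgroup.mpr ⟨a q, hm (by simp), hav q⟩
    have := mul_mem (Subgroup.mem_sup_right hqm) (Subgroup.mem_sup_left hq)
    rwa [mul_inv_cancel_left] at this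

theorem exists_finset_residueSubfield_le {k l : Subfield Ω} (hkl : k ≤ l)
    (h : (residueSubfield C k).relfinrank (residueSubfield C l) ≠ 0) :
    ∃ T : Finset Ω, (T : Set Ω) ⊆ l ∧ ∀ m : Subfield Ω, (T : Set Ω) ⊆ m →
      residueSubfield C l ≤ residueSubfield C k ⊔ residueSubfield C m := by
  obtain ⟨T, hT, hle⟩ := exists_finset_le_sup_closure (residueSubfield_mono C hkl) h
  choose! r hr hres using fun (y : IsLocalRing.ResidueField C) (hy : y ∈ T) ↦
    mem_residueSubfield.mp (hT hy)
  refine ⟨T.image fun y ↦ (r y : Ω), ?_, fun m hm ↦ hle.trans (sup_le_sup_left ?_ _)⟩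
  · intro x hx
    obtain ⟨y, hy, rfl⟩ := Finset.mem_image.mp hx
    exact hr y hy
  · rw [Subfield.closure_le]
    exact fun y hy ↦ ⟨r y, hm (Finset.mem_image_of_mem _ hy), hres y hy⟩

theorem ramResidueProd_pos_and_le {k l : Subfield Ω} (hkl : k ≤ l) (h : k.relfinrank l ≠ 0) :
    0 < ramResidueProd C k l ∧ ramResidueProd C k l ≤ k.relfinrank l := by
  have hfin := (relfinrank_ne_zero_iff hkl).mp h
  let Q := valueSubgroup C l ⧸ (valueSubgroup C k).subgroupOf (valueSubgroup C l)
  have hr : ∀ q : Q, ∃ x ∈ l, C.valuation x = (q.out : C.ValueGroupˣ) :=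
    fun q ↦ mem_valueSubgroup.mp q.out.2
  choose a hal hav using hr
  have ha0 : ∀ q, a q ≠ 0 := by
    intro q h0
    have := hav q
    rw [h0, map_zero] at this
    exact Units.ne_zero _ this.symm
  have hle := residueSubfield_mono C hkl
  let β := Module.Basis.ofVectorSpace (residueSubfield C k) (Subfield.extendScalars hle)
  let J := Module.Basis.ofVectorSpaceIndex (residueSubfield C k) (Subfield.extendScalars hle)
  choose b hbl hbres using fun j : J ↦ mem_residueSubfield.mp (β j).2
  have hb : LinearIndependent (residueSubfield C k) fun j ↦ IsLocalRing.residue C (b j) := by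
    simp_rw [hbres]
    exact β.linearIndependent.map' (Subfield.extendScalars hle).val.toLinearMap
      (LinearMap.ker_eq_bot.mpr Subtype.val_injective)
  have ha : ∀ q q', ∀ x ∈ k, C.valuation (a q) = C.valuation (x * a q') → q = q' := by
    intro q q' x hx heq
    rw [← q.out_eq', ← q'.out_eq', eq_comm]
    refine QuotientGroup.eq.mpr ?_
    refine mem_valueSubgroup.mpr ⟨x, hx, ?_⟩
    rw [map_mul, hav, hav] at heq
    change _ = (((q'.out : C.ValueGroupˣ)⁻¹ * (q.out : C.ValueGroupˣ) : C.ValueGroupˣ) : C.ValueGroup)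
    rw [Units.val_mul, heq, mul_comm, mul_assoc, Units.mul_inv, mul_one]
  have hli := linearIndependent_mul ha0 ha hb
  let m : Q × J → Subfield.extendScalars hkl := fun ij ↦
    ⟨a ij.1 * (b ij.2 : Ω), mul_mem (hal _) (hbl _)⟩
  have hli' : LinearIndependent k m :=
    LinearIndependent.of_comp (Subfield.extendScalars hkl).val.toLinearMap hli
  have hQJ : Finite (Q × J) := hli'.finite
  have hJ : Nonempty J := β.index_nonempty
  have hQ : Finite Q := Finite.prod_left J
  have hJ' : Finite J := Finite.prod_right Q
  have hcard : ramResidueProd C k l = Nat.card (Q × J) := by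
    rw [Nat.card_prod, ramResidueProd, Subfield.relfinrank_eq_finrank_of_le hle,
      Module.finrank_eq_nat_card_basis β]
    rfl
  rw [hcard]
  refine ⟨Nat.card_pos, ?_⟩
  have := Fintype.ofFinite (Q × J)
  rw [Nat.card_eq_fintype_card, Subfield.relfinrank_eq_finrank_of_le hkl]
  exact hli'.fintype_card_le_finrank

end FundamentalInequality

section Core

variable {Ω : Type*} [Field Ω] {C : ValuationSubring Ω}

theorem relfinrank_eq_ramResidueProd_of_le {k l m : Subfield Ω} (hkl : k ≤ l) (hlm : l ≤ m)
    (hfin : k.relfinrank m ≠ 0) (h : k.relfinrank m ≤ ramResidueProd C k m) :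
    k.relfinrank l = ramResidueProd C k l ∧ l.relfinrank m = ramResidueProd C l m := by
  rw [← Subfield.relfinrank_mul_relfinrank hkl hlm] at h hfin
  rw [← ramResidueProd_mul C hkl hlm] at h
  have h₁ := ramResidueProd_pos_and_le (C := C) hkl (left_ne_zero_of_mul hfin)
  have h₂ := ramResidueProd_pos_and_le (C := C) hlm (right_ne_zero_of_mul hfin)
  constructor <;> nlinarith

theorem ramResidueProd_le_of_le_sup {f m e n : Subfield Ω} (hfm : f ≤ m) (hnm : n ≤ m)
    (hef : e ≤ f) (hen : e ≤ n) (hfin : ramResidueProd C e n ≠ 0)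
    (hv : valueSubgroup C m ≤ valueSubgroup C f ⊔ valueSubgroup C n)
    (hr : residueSubfield C m ≤ residueSubfield C f ⊔ residueSubfield C n) :
    ramResidueProd C f m ≤ ramResidueProd C e n := by
  have hv' := hv.antisymm (sup_le (valueSubgroup_mono C hfm) (valueSubgroup_mono C hnm))
  have hr' := hr.antisymm (sup_le (residueSubfield_mono C hfm) (residueSubfield_mono C hnm))
  unfold ramResidueProd at hfin ⊢
  rw [hv', hr', Subgroup.relIndex_sup_left]
  exact Nat.mul_le_mul
    (Subgroup.relIndex_le_of_le_left (valueSubgroup_mono C hef) (left_ne_zero_of_mul hfin))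
    (relfinrank_sup_ne_zero_and_le (residueSubfield_mono C hef) (residueSubfield_mono C hen)
      (right_ne_zero_of_mul hfin)).2

theorem relfinrank_eq_ramResidueProd_of_map_le {σ : Ω →+* Ω} (hσs : Function.Surjective σ)
    (hσ : C.comap σ = C) {k s n : Subfield Ω} (hks : k ≤ s) (hsn : s ≤ n)
    (hfin : k.relfinrank s ≠ 0) (hfin' : s.relfinrank n ≠ 0) (hk : k.map σ ≤ k)
    (hs : s.map σ ≤ s) (hsep : s ≤ k ⊔ s.map σ) (hpi : n.map σ ≤ s)
    (halg : ∀ x, σ x ∈ k → IsIntegral k x)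
    (H : ∀ e, k ≤ e → e.map σ ≤ k → k.relfinrank e ≠ 0 →
      k.relfinrank e = ramResidueProd C k e) :
    s.relfinrank n = ramResidueProd C s n := by
  have hkf : k ≤ k.comap σ := Subfield.map_le_iff_le_comap.mp hk
  have hsm : s ≤ s.comap σ := Subfield.map_le_iff_le_comap.mp hs
  have hnm : n ≤ s.comap σ := Subfield.map_le_iff_le_comap.mp hpi
  have hfm : k.comap σ ≤ s.comap σ := fun x hx ↦ hks hx
  have hprod : ramResidueProd C (k.comap σ) (s.comap σ) = ramResidueProd C k s := by
    rw [← ramResidueProd_map C hσ hfm, Subfield.map_comap_eq_self_of_surjective hσs,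
      Subfield.map_comap_eq_self_of_surjective hσs]
  have hpos : 0 < ramResidueProd C k s := (ramResidueProd_pos_and_le hks hfin).1
  have hne : ramResidueProd C (k.comap σ) (s.comap σ) ≠ 0 := hprod ▸ hpos.ne'
  have hmsf : s.comap σ ≤ s ⊔ k.comap σ := by
    intro x hx
    have h := hsep hx
    rw [← Subfield.map_comap_eq_self_of_surjective hσs k, ← Subfield.map_sup, sup_comm] at h
    obtain ⟨y, hy, hyx⟩ := h
    rwa [← σ.injective hyx]
  obtain ⟨T₁, hT₁, hT₁'⟩ := exists_finset_valueSubgroup_le (left_ne_zero_of_mul hne)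
  obtain ⟨T₂, hT₂, hT₂'⟩ := exists_finset_residueSubfield_le hfm (right_ne_zero_of_mul hne)
  obtain ⟨T₃, hT₃, hT₃'⟩ := exists_finset_le_sup_closure hsn hfin'
  obtain ⟨e, hke, hef, hkefin, hT⟩ := exists_finite_le_of_finset_subset_sup hkf
    (fun x hx ↦ halg x hx) (T₁ ∪ T₂ ∪ T₃) (l := s) (by
      push_cast
      exact (Set.union_subset (Set.union_subset hT₁ hT₂) (hT₃.trans hnm)).trans hmsf)
  push_cast at hT
  rw [Set.union_subset_iff, Set.union_subset_iff] at hT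
  have hn : n ≤ s ⊔ e := hT₃'.trans (sup_le le_sup_left (Subfield.closure_le.mpr hT.2))
  have hse : s ⊔ e ≤ s.comap σ := sup_le hsm (hef.trans hfm)
  have hdeg := relfinrank_sup_ne_zero_and_le hks hke hkefin
  have hdeg' := (relfinrank_sup_ne_zero_and_le hke hks hfin).1
  rw [sup_comm] at hdeg'
  have hle : ramResidueProd C k s ≤ ramResidueProd C e (s ⊔ e) := by
    rw [← hprod]
    exact ramResidueProd_le_of_le_sup hfm hse hef le_sup_right
      (ramResidueProd_pos_and_le le_sup_right hdeg').1.ne' (hT₁' _ hT.1.1) (hT₂' _ hT.1.2)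
  have he := H e hke (Subfield.map_le_iff_le_comap.mpr hef) hkefin
  have hmul : ramResidueProd C k s * ramResidueProd C s (s ⊔ e) =
      ramResidueProd C k e * ramResidueProd C e (s ⊔ e) := by
    rw [ramResidueProd_mul C hks le_sup_left, ramResidueProd_mul C hke le_sup_right]
  have hge : ramResidueProd C k e ≤ ramResidueProd C s (s ⊔ e) := by
    refine Nat.le_of_mul_le_mul_left ?_ hpos
    rw [hmul, mul_comm]
    exact Nat.mul_le_mul_left _ hle
  exact (relfinrank_eq_ramResidueProd_of_le hsn hn hdeg.1 (hdeg.2.trans (he ▸ hge))).1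

theorem exists_comap_eq {F : Type*} [Field F] (B : ValuationSubring F) (i : F →+* Ω) :
    ∃ D : ValuationSubring Ω, D.comap i = B := by
  obtain ⟨D, hD, hloc⟩ := IsLocalRing.exists_factor_valuationRing (i.comp B.subtype)
  refine ⟨D, le_antisymm (fun x hx ↦ ?_) fun x hx ↦ hD ⟨x, hx⟩⟩
  by_contra hxB
  have hinv : x⁻¹ ∈ B := (B.mem_or_inv_mem x).resolve_left hxB
  have hx0 : x ≠ 0 := by
    rintro rfl
    exact hxB (zero_mem B)
  have hu : IsUnit (⟨x⁻¹, hinv⟩ : B) := by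
    refine hloc.map_nonunit _ (isUnit_iff_exists_inv.mpr ⟨⟨i x, hx⟩, Subtype.ext ?_⟩)
    change i x⁻¹ * i x = 1
    rw [← map_mul, inv_mul_cancel₀ hx0, map_one]
  obtain ⟨y, hy⟩ := isUnit_iff_exists_inv.mp hu
  have hy' : x⁻¹ * (y : F) = 1 := congrArg Subtype.val hy
  have : (y : F) = x := by rw [← inv_inv x]; exact eq_inv_of_mul_eq_one_right hy'
  exact hxB (this ▸ y.2)

theorem comap_iterateFrobenius (p n : ℕ) [ExpChar Ω p] :
    C.comap (iterateFrobenius Ω p n) = C := by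
  ext x
  rw [ValuationSubring.mem_comap, iterateFrobenius_def, ← C.valuation_le_one_iff,
    ← C.valuation_le_one_iff, map_pow,
    pow_le_one_iff (pow_ne_zero n (expChar_pos Ω p).ne')]

end Core

theorem IsInsepDefectless.relfinrank_eq_ramResidueProd {K Ω : Type u} [Field K] [Field Ω]
    {A : ValuationSubring K} (hA : IsInsepDefectless A) {C : ValuationSubring Ω} {i : K →+* Ω}
    (hi : C.comap i = A) (p n : ℕ) [ExpChar K p] {e : Subfield Ω} (he : i.fieldRange ≤ e)
    (hpow : ∀ x ∈ e, x ^ p ^ n ∈ i.fieldRange) (hfin : i.fieldRange.relfinrank e ≠ 0) :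
    i.fieldRange.relfinrank e = ramResidueProd C i.fieldRange e := by
  let f : K →+* e := i.codRestrict e fun x ↦ he ⟨x, rfl⟩
  let _ : Algebra K e := f.toAlgebra
  have hK : (e.subtype.comp (algebraMap K e)).fieldRange = i.fieldRange := rfl
  have hE : e.subtype.fieldRange = e := e.fieldRange_subtype
  have hfd : FiniteDimensional K e := by
    apply FiniteDimensional.of_finrank_pos
    rw [finrank_eq_relfinrank_fieldRange e.subtype, hK, hE]
    exact Nat.pos_of_ne_zero hfin
  have hpi : IsPurelyInseparable K e := by
    rw [isPurelyInseparable_iff_pow_mem K p]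
    intro x
    obtain ⟨y, hy⟩ := hpow x x.2
    exact ⟨n, y, Subtype.ext hy⟩
  have h := hA e hfd hpi (C.comap e.subtype) hi
  rwa [isDefectless_iff_relfinrank_eq (B := C.comap e.subtype) hi rfl, hK, hE] at h

/-- Every finite extension of an inseparably defectless field of characteristic `p > 0` is again
an inseparably defectless field. -/
theorem statement18 {K L : Type u} [Field K] [Field L] [Algebra K L]
    (p : ℕ) (hp : 0 < p) [CharP K p]
    (A : ValuationSubring K) (hA : IsInsepDefectless A)
    [FiniteDimensional K L]
    (B : ValuationSubring L) (hB : B.comap (algebraMap K L) = A) :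
    IsInsepDefectless B := by
  intro M _ _ _ _ D hD
  have hprime : p.Prime := (CharP.char_is_prime_or_zero K p).resolve_right hp.ne'
  have hK : ExpChar K p := ExpChar.prime hprime
  have hL : ExpChar L p := expChar_of_injective_algebraMap (algebraMap K L).injective p
  have hM : ExpChar M p := expChar_of_injective_algebraMap (algebraMap L M).injective p
  let Ω := AlgebraicClosure M
  have hΩ : ExpChar Ω p := expChar_of_injective_algebraMap (algebraMap M Ω).injective p
  let iM : M →+* Ω := algebraMap M Ω
  let iL : L →+* Ω := iM.comp (algebraMap L M)
  let iK : K →+* Ω := iL.comp (algebraMap K L)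
  obtain ⟨C, hC⟩ := exists_comap_eq D iM
  let S := separableClosure K L
  let s : Subfield Ω := S.toSubfield.map iL
  have hpi : IsPurelyInseparable S M := by
    have := separableClosure.isPurelyInseparable K L
    exact IsPurelyInseparable.trans S L M
  have hfd : FiniteDimensional S M := FiniteDimensional.trans S L M
  have hexp : IsPurelyInseparable.HasExponent S M :=
    IsPurelyInseparable.hasExponent_of_finiteDimensional
  have hSp : ExpChar S p := expChar_of_injective_algebraMap (algebraMap K S).injective p
  obtain ⟨n, hn⟩ : ∃ n : ℕ, ∀ x : M, x ^ p ^ n ∈ (algebraMap S M).range :=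
    ⟨_, IsPurelyInseparable.exponent_def' S p⟩
  let σ := iterateFrobenius Ω p n
  have hself : ∀ t : Subfield Ω, t.map σ ≤ t := by
    rintro t _ ⟨x, hx, rfl⟩
    exact pow_mem hx _
  have hks : iK.fieldRange ≤ s := by
    rintro _ ⟨x, rfl⟩
    exact ⟨algebraMap K L x, S.algebraMap_mem x, rfl⟩
  have hsl : s ≤ iL.fieldRange := by
    rintro _ ⟨x, -, rfl⟩
    exact ⟨x, rfl⟩
  have hlm : iL.fieldRange ≤ iM.fieldRange := by
    rintro _ ⟨x, rfl⟩
    exact ⟨_, rfl⟩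
  have hfinKL : iK.fieldRange.relfinrank iL.fieldRange ≠ 0 := by
    rw [← finrank_eq_relfinrank_fieldRange iL]
    exact Module.finrank_pos.ne'
  have hfinLM : iL.fieldRange.relfinrank iM.fieldRange ≠ 0 := by
    rw [← finrank_eq_relfinrank_fieldRange iM]
    exact Module.finrank_pos.ne'
  rw [← Subfield.relfinrank_mul_relfinrank hks hsl] at hfinKL
  have hfinSM : s.relfinrank iM.fieldRange ≠ 0 := by
    rw [← Subfield.relfinrank_mul_relfinrank hsl hlm]
    exact mul_ne_zero (right_ne_zero_of_mul hfinKL) hfinLM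
  have hsep : s ≤ iK.fieldRange ⊔ s.map σ := by
    let T : IntermediateField K L :=
      ((iK.fieldRange ⊔ s.map σ).comap iL).toIntermediateField fun x ↦
        le_sup_left (a := iK.fieldRange) ⟨x, rfl⟩
    have hS : IntermediateField.adjoin K (S : Set L) = S := IntermediateField.adjoin_self K S
    have hsepS : Algebra.IsSeparable K (IntermediateField.adjoin K (S : Set L)) := by
      rw [hS]
      infer_instance
    have hST : S ≤ T := by
      rw [← hS, IntermediateField.adjoin_eq_adjoin_pow_expChar_pow_of_isSeparable K L S p n,
        IntermediateField.adjoin_le_iff]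
      rintro _ ⟨x, hx, rfl⟩
      exact le_sup_right (a := iK.fieldRange) ⟨iL x, ⟨x, hx, rfl⟩, (map_pow iL x _).symm⟩
    rintro _ ⟨x, hx, rfl⟩
    exact hST hx
  have hms : iM.fieldRange.map σ ≤ s := by
    rintro _ ⟨_, ⟨x, rfl⟩, rfl⟩
    obtain ⟨y, hy⟩ := hn x
    exact ⟨y, y.2, (congrArg iM hy).trans (map_pow iM x _)⟩
  have hσs : Function.Surjective σ := fun x ↦
    IsAlgClosed.exists_pow_nat_eq x (pow_pos hp n)
  have halg : ∀ x, σ x ∈ iK.fieldRange → IsIntegral iK.fieldRange x := fun x hx ↦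
    IsIntegral.of_pow (pow_pos hp n) (isIntegral_algebraMap (x := (⟨_, hx⟩ : iK.fieldRange)))
  have hCA : C.comap iK = A := by
    rw [← hB, ← hD, ← hC]
    rfl
  have hSM : s.relfinrank iM.fieldRange = ramResidueProd C s iM.fieldRange :=
    relfinrank_eq_ramResidueProd_of_map_le hσs (comap_iterateFrobenius p n) hks (hsl.trans hlm)
      (left_ne_zero_of_mul hfinKL) hfinSM (hself _) (hself _) hsep hms halg
      fun e hke hek hfin ↦ hA.relfinrank_eq_ramResidueProd hCA p n hke
        (fun x hx ↦ hek ⟨x, hx, rfl⟩) hfin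
  exact (isDefectless_iff_relfinrank_eq hD hC).mpr
    (relfinrank_eq_ramResidueProd_of_le hsl hlm hfinSM hSM.le).2

end ValuedDefect
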